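/- arXiv:2401.03485 — 8 statements merged into one kernel-verified Lean document; each statement's English description precedes it below -/
import Mathlib

section
/- Let G be a finite group, p a prime, and x a p-element of G such that x^G ∩ C_G(x) = {x}. Then for every Sylow p-subgroup P of G containing x, the element x lies in the center Z(P) of P, and moreover x^G ∩ P = {x}. -/
/-- In a group satisfying the normalizer condition, an element that commutes with none of its
other conjugates is central. -/
theorem mem_center_of_forall_commute_conj {H : Type*} [Group H] (hH : NormalizerCondition H)
    {x : H} (hx : ∀ g : H, Commute x (g * x * g⁻¹) → g * x * g⁻¹ = x) :
    x ∈ Subgroup.center H := by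
  have htop : Subgroup.centralizer {x} = (⊤ : Subgroup H) := by
    refine normalizerCondition_iff_only_full_group_self_normalizing.mp hH _
      (le_antisymm (fun g hg => ?_) Subgroup.le_normalizer)
    have hmem : g * x * g⁻¹ ∈ Subgroup.centralizer {x} :=
      (Subgroup.mem_normalizer_iff.mp hg x).mp (Subgroup.mem_centralizer_singleton_iff.mpr rfl)
    have hconj := hx g (Subgroup.mem_centralizer_singleton_iff.mp hmem).symm
    exact Subgroup.mem_centralizer_singleton_iff.mpr (mul_inv_eq_iff_eq_mul.mp hconj)
  refine Subgroup.mem_center_iff.mpr fun g => ?_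
  exact Subgroup.mem_centralizer_singleton_iff.mp (htop ▸ Subgroup.mem_top g)

theorem p_element_center_of_sylow {G : Type*} [Group G] [Fintype G] (p : ℕ) (hp : p.Prime)
    (x : G) (hx : ∃ n : ℕ, orderOf x = p ^ n)
    (hclass : {z : G | ∃ g : G, g * x * g⁻¹ = z} ∩ (Subgroup.centralizer {x} : Set G) = {x}) :
    ∀ (P : Sylow p G) (hxP : x ∈ (P : Subgroup G)),
      (⟨x, hxP⟩ : (P : Subgroup G)) ∈ Subgroup.center (P : Subgroup G) ∧
      {z : G | ∃ g : G, g * x * g⁻¹ = z} ∩ ((P : Subgroup G) : Set G) = {x} := by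
  intro P hxP
  have : Fact p.Prime := ⟨hp⟩
  have hconj : ∀ g : G, Commute x (g * x * g⁻¹) → g * x * g⁻¹ = x := fun g hg =>
    hclass.subset ⟨⟨g, rfl⟩, Subgroup.mem_centralizer_singleton_iff.mpr hg.symm⟩
  have hnil : Group.IsNilpotent (P : Subgroup G) := P.isPGroup'.isNilpotent
  have hcenter : (⟨x, hxP⟩ : (P : Subgroup G)) ∈ Subgroup.center (P : Subgroup G) :=
    mem_center_of_forall_commute_conj Group.normalizerCondition_of_isNilpotent fun g hg =>
      Subtype.ext (hconj g (congrArg Subtype.val hg))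
  refine ⟨hcenter, Set.Subset.antisymm ?_ ?_⟩
  · rintro _ ⟨⟨g, rfl⟩, hgP⟩
    exact hconj g (congrArg Subtype.val (Subgroup.mem_center_iff.mp hcenter ⟨_, hgP⟩)).symm
  · rintro _ rfl
    exact ⟨⟨1, by simp⟩, hxP⟩
end

section
/- Let G be a finite group, p a prime, and x ∈ G such that the cyclic subgroup ⟨x⟩ is a Sylow p-subgroup of G. Then the following are equivalent: (i) x^G has the ⋆-property; (ii) ⟨x⟩ has a normal p-complement, i.e. there exists a normal subgroup H of G with |H| coprime to p such that G = H⟨x⟩ (so G ≅ H ⋊ ⟨x⟩). -/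
open scoped Pointwise

/-- The conjugacy class `x^G` has the ⋆-property: every `y ∈ x^G` is conjugate to `x`
by an element of the subgroup generated by `x` and `y`. -/
def StarProperty {G : Type*} [Group G] (x : G) : Prop :=
  ∀ y ∈ {z : G | ∃ g : G, g * x * g⁻¹ = z},
    ∃ h ∈ Subgroup.closure ({x, y} : Set G), y = h * x * h⁻¹

theorem conj_mul_inv_mem_of_mul_zpowers_eq_univ {G : Type*} [Group G] {H : Subgroup G}
    (hH : H.Normal) {x : G} (hHx : (H : Set G) * (Subgroup.zpowers x : Set G) = Set.univ)
    (g : G) : g * x * g⁻¹ * x⁻¹ ∈ H := by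
  obtain ⟨h, hh, z, hz, rfl⟩ : g ∈ (H : Set G) * (Subgroup.zpowers x : Set G) :=
    hHx ▸ Set.mem_univ g
  obtain ⟨i, rfl⟩ := Subgroup.mem_zpowers_iff.mp hz
  have key : h * x ^ i * x * (h * x ^ i)⁻¹ * x⁻¹ = h * (x * h⁻¹ * x⁻¹) := by group
  exact key ▸ H.mul_mem hh (hH.conj_mem _ (H.inv_mem hh) x)

theorem Subgroup.zpowers_conj {G : Type*} [Group G] (g x : G) :
    Subgroup.zpowers (g * x * g⁻¹) = MulAut.conj g • Subgroup.zpowers x := by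
  rw [← MulAut.conj_apply]
  exact (MonoidHom.map_zpowers (MulAut.conj g).toMonoidHom x).symm

theorem StarProperty.normalizer_le_centralizer {G : Type*} [Group G] {x : G}
    (hx : StarProperty x) :
    Subgroup.normalizer (Subgroup.zpowers x : Set G) ≤
      Subgroup.centralizer (Subgroup.zpowers x : Set G) := by
  intro n hn
  have hy : n * x * n⁻¹ ∈ Subgroup.zpowers x :=
    (Subgroup.mem_normalizer_iff.mp hn x).mp (Subgroup.mem_zpowers x)
  obtain ⟨h, hh, hyx⟩ := hx _ ⟨n, rfl⟩
  have hle : Subgroup.closure {x, n * x * n⁻¹} ≤ Subgroup.zpowers x := by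
    simp [Subgroup.closure_le, Set.insert_subset_iff, hy]
  obtain ⟨i, rfl⟩ := Subgroup.mem_zpowers_iff.mp (hle hh)
  have hnx : Commute n x := by
    rw [show x ^ i * x * (x ^ i)⁻¹ = x by group] at hyx
    exact mul_inv_eq_iff_eq_mul.mp hyx
  rw [Subgroup.mem_centralizer_iff]
  rintro _ ⟨j, rfl⟩
  exact (hnx.zpow_right j).eq.symm

theorem Sylow.starProperty_of_normal_complement {G : Type*} [Group G] [Finite G]
    {p : ℕ} [Fact p.Prime] {x : G} {P : Sylow p G} (hP : (P : Subgroup G) = Subgroup.zpowers x)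
    {H : Subgroup G} (hH : H.Normal) (hcop : Nat.Coprime (Nat.card H) p)
    (hHx : (H : Set G) * (Subgroup.zpowers x : Set G) = Set.univ) : StarProperty x := by
  rintro _ ⟨g, rfl⟩
  set y := g * x * g⁻¹ with hy
  let K := Subgroup.closure ({x, y} : Set G)
  have hQ : ((g • P : Sylow p G) : Subgroup G) = Subgroup.zpowers y := by
    rw [Sylow.coe_subgroup_smul, hP, hy, Subgroup.zpowers_conj]
  have hxP : x ∈ (P : Subgroup G) := by
    rw [hP]
    exact Subgroup.mem_zpowers x
  have hxK : (P : Subgroup G) ≤ K := by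
    rw [hP, Subgroup.zpowers_le]
    exact Subgroup.subset_closure (by simp)
  have hyK : ((g • P : Sylow p G) : Subgroup G) ≤ K := by
    rw [hQ, Subgroup.zpowers_le]
    exact Subgroup.subset_closure (by simp)
  obtain ⟨k, hk⟩ := MulAction.exists_smul_eq K (P.subtype hxK) ((g • P).subtype hyK)
  have hkx : (k : G) * x * (k : G)⁻¹ ∈ Subgroup.zpowers y := by
    have hmem : (k * ⟨x, hxK hxP⟩ * k⁻¹ : K) ∈ (g • P).subtype hyK := by
      rw [← hk]
      exact Subgroup.smul_mem_pointwise_smul _ (MulAut.conj k) _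
        (Subgroup.mem_subgroupOf.mpr hxP)
    rw [← hQ]
    exact Subgroup.mem_subgroupOf.mp hmem
  refine ⟨k, k.2, ?_⟩
  have hmemH : (k : G) * x * (k : G)⁻¹ * y⁻¹ ∈ H := by
    have h := H.mul_mem (conj_mul_inv_mem_of_mul_zpowers_eq_univ hH hHx (k : G))
      (H.inv_mem (conj_mul_inv_mem_of_mul_zpowers_eq_univ hH hHx g))
    simpa [hy, mul_assoc] using h
  have hmemy : (k : G) * x * (k : G)⁻¹ * y⁻¹ ∈ Subgroup.zpowers y :=
    mul_mem hkx (inv_mem (Subgroup.mem_zpowers y))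
  have hdisj : Disjoint H (Subgroup.zpowers y) := by
    obtain ⟨n, hn⟩ := IsPGroup.iff_card.mp (hQ ▸ (g • P).isPGroup')
    exact Subgroup.disjoint_of_coprime_natCard (hn ▸ hcop.pow_right n)
  exact (mul_inv_eq_one.mp (Subgroup.disjoint_def.mp hdisj hmemH hmemy)).symm

theorem star_iff_normal_p_complement_of_cyclic_sylow {G : Type*} [Group G] [Fintype G]
    (p : ℕ) (hp : p.Prime) (x : G)
    (hSyl : ∃ P : Sylow p G, (P : Subgroup G) = Subgroup.zpowers x) :
    StarProperty x ↔
      ∃ H : Subgroup G, H.Normal ∧ Nat.Coprime (Nat.card H) p ∧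
        (H : Set G) * (Subgroup.zpowers x : Set G) = Set.univ := by
  have : Fact p.Prime := ⟨hp⟩
  obtain ⟨P, hP⟩ := hSyl
  constructor
  · intro hx
    have hN : Subgroup.normalizer ((P : Subgroup G) : Set G) ≤
        Subgroup.centralizer (P : Set G) := by
      have h := hx.normalizer_le_centralizer
      rwa [← hP] at h
    refine ⟨(MonoidHom.transferSylow P hN).ker, inferInstance, ?_, ?_⟩
    · exact ((hp.coprime_iff_not_dvd).mpr
        (MonoidHom.not_dvd_card_ker_transferSylow P hN)).symm
    · rw [← hP]
      exact (MonoidHom.ker_transferSylow_isComplement' P hN).mul_eq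
  · rintro ⟨H, hH, hcop, hHx⟩
    exact Sylow.starProperty_of_normal_complement hP hH hcop hHx
end

section
/- Let G be a finite group, π a set of primes, and x ∈ G a π-element, i.e. every prime divisor of the order of x belongs to π. If there exists a normal subgroup N of G whose order is divisible by no prime in π and such that G = N C_G(x) (equivalently, G = O_{π'}(G) C_G(x)), then the conjugacy class x^G has the ⋆-property. -/
open scoped Pointwise

/-- If `x` normalizes a finite subgroup `M` of order coprime to the order of `x`, then every
element of the coset `M x` whose order divides that of `x` is conjugate to `x` by an element
of `M`. -/
theorem Subgroup.exists_mem_conj_eq_of_coprime {G : Type*} [Group G] (M : Subgroup G) [Finite M]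
    {x y : G} (hnorm : ∀ m ∈ M, x * m * x⁻¹ ∈ M) (hcop : (orderOf x).Coprime (Nat.card M))
    (hyM : y * x⁻¹ ∈ M) (hy : y ^ orderOf x = 1) : ∃ h ∈ M, y = h * x * h⁻¹ := by
  let C : Subgroup M := (Subgroup.centralizer {x}).subgroupOf M
  have hcomm (c : C) : Commute x (c : M) :=
    (Subgroup.mem_centralizer_singleton_iff.mp (Subgroup.mem_subgroupOf.mp c.2)).symm
  have hcard (c : C) : ((c : M) : G) ^ Nat.card M = 1 := by
    exact_mod_cast congrArg Subtype.val (pow_card_eq_one' (x := (c : M)))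
  -- `F (g C, c) * x` has commuting coprime parts `g x g⁻¹` and `g c g⁻¹`.
  let F : (M ⧸ C) × C → M := fun p =>
    ⟨p.1.out * (x * p.2) * (p.1.out : G)⁻¹ * x⁻¹, by
      have h := M.mul_mem p.1.out.2 (hnorm _ (M.mul_mem p.2.1.2 (M.inv_mem p.1.out.2)))
      simpa [mul_assoc] using h⟩
  have hF : Function.Injective F := by
    rintro ⟨q, c⟩ ⟨q', c'⟩ h
    have h : (q.out : G) * (x * c) * (q.out : G)⁻¹ = q'.out * (x * c') * (q'.out : G)⁻¹ :=
      mul_right_cancel (congrArg Subtype.val h)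
    obtain ⟨e, he₁, he₂⟩ := Nat.chineseRemainder hcop 1 0
    have hxe : x ^ e = x := by simpa using pow_eq_pow_iff_modEq.mpr he₁
    have hpow (d : C) : (x * d) ^ e = x := by
      obtain ⟨k, rfl⟩ := (Nat.modEq_zero_iff_dvd.mp he₂)
      rw [(hcomm d).mul_pow, hxe, pow_mul, hcard, one_pow, mul_one]
    have hx : (q.out : G) * x * (q.out : G)⁻¹ = q'.out * x * (q'.out : G)⁻¹ := by
      simpa only [conj_pow, hpow] using congrArg (· ^ e) h
    have hq : q = q' := by
      rw [← q.out_eq', ← q'.out_eq', QuotientGroup.eq]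
      refine Subgroup.mem_subgroupOf.mpr (Subgroup.mem_centralizer_singleton_iff.mpr ?_)
      have := congrArg (fun z => (q.out : G)⁻¹ * z * q'.out) hx
      simpa [mul_assoc] using this.symm
    subst hq
    simpa using h
  have hsurj : Function.Surjective F :=
    (Finite.injective_iff_surjective_of_equiv
      (Subgroup.groupEquivQuotientProdSubgroup (s := C)).symm).mp hF
  obtain ⟨⟨q, c⟩, h⟩ := hsurj ⟨y * x⁻¹, hyM⟩
  have h : (q.out : G) * (x * c) * (q.out : G)⁻¹ = y := mul_right_cancel (congrArg Subtype.val h)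
  have hc : ((c : M) : G) ^ orderOf x = 1 := by
    rw [← h, conj_pow, conj_eq_one_iff, (hcomm c).mul_pow, pow_orderOf_eq_one, one_mul] at hy
    exact hy
  have hc1 : ((c : M) : G) = 1 := by
    rw [← orderOf_eq_one_iff]
    exact Nat.eq_one_of_dvd_coprimes hcop (orderOf_dvd_of_pow_eq_one hc)
      (orderOf_dvd_of_pow_eq_one (hcard c))
  exact ⟨q.out, q.out.2, by rw [← h, hc1, mul_one]⟩

theorem star_of_pi_complement {G : Type*} [Group G] [Fintype G] (π : Set ℕ) (x : G)
    (hx : ∀ q : ℕ, q.Prime → q ∣ orderOf x → q ∈ π)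
    (hN : ∃ N : Subgroup G, N.Normal ∧ (∀ q ∈ π, ¬ q ∣ Nat.card N) ∧
      (N : Set G) * (Subgroup.centralizer {x} : Set G) = Set.univ) :
    StarProperty x := by
  obtain ⟨N, hnormal, hπ, hprod⟩ := hN
  rintro y ⟨g, rfl⟩
  obtain ⟨n, hn, c, hc, rfl⟩ : g ∈ (N : Set G) * (Subgroup.centralizer {x} : Set G) :=
    hprod ▸ Set.mem_univ g
  have hconj : n * c * x * (n * c)⁻¹ = n * x * n⁻¹ := by
    have hc : c * x = x * c := Subgroup.mem_centralizer_singleton_iff.mp hc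
    rw [mul_assoc n, hc]
    group
  simp only [hconj]
  set H := Subgroup.closure ({x, n * x * n⁻¹} : Set G)
  have hxH : x ∈ H := Subgroup.subset_closure (by simp)
  have hyH : n * x * n⁻¹ ∈ H := Subgroup.subset_closure (by simp)
  have hcop : (orderOf x).Coprime (Nat.card N) :=
    Nat.coprime_of_dvd fun q hq hqx => hπ q (hx q hq hqx)
  obtain ⟨h, hh, heq⟩ := (N ⊓ H).exists_mem_conj_eq_of_coprime (x := x) (y := n * x * n⁻¹)
    (fun m hm => ⟨hnormal.conj_mem m hm.1 x, H.mul_mem (H.mul_mem hxH hm.2) (H.inv_mem hxH)⟩)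
    (hcop.coprime_dvd_right (Subgroup.card_dvd_of_le inf_le_left))
    ⟨by simpa [mul_assoc] using N.mul_mem hn (hnormal.conj_mem _ (N.inv_mem hn) x),
      H.mul_mem hyH (H.inv_mem hxH)⟩
    (by rw [conj_pow, pow_orderOf_eq_one, mul_one, mul_inv_cancel])
  exact ⟨h, hh.2, heq⟩
end

section
/- Let G be a finite group, p a prime, and x a p-element of G such that G is generated by the conjugacy class x^G. Let D be the subgroup of G generated by {y x⁻¹ : y ∈ x^G} (a normal subgroup of G). The following are equivalent: (i) there exists a normal subgroup N of G with order not divisible by p and G = N C_G(x); (ii) ⟨x⟩ has a normal p-complement in G; (iii) G = D⟨x⟩, D ∩ ⟨x⟩ = 1, and the order of D is coprime to the order of x. -/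
open scoped Pointwise

/-- The subgroup generated by the differences `y * x⁻¹` of conjugates `y` of `x`, i.e. the
displacement group of the conjugation quandle on the class of `x`. -/
def displacementSubgroup {G : Type*} [Group G] (x : G) : Subgroup G :=
  Subgroup.closure {w : G | ∃ y ∈ {z : G | ∃ g : G, g * x * g⁻¹ = z}, w = y * x⁻¹}

namespace displacementSubgroup

variable {G : Type*} [Group G] {x : G}

theorem conj_mul_inv_mem (x g : G) : g * x * g⁻¹ * x⁻¹ ∈ displacementSubgroup x :=
  Subgroup.subset_closure ⟨_, ⟨g, rfl⟩, rfl⟩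

theorem le_iff {N : Subgroup G} :
    displacementSubgroup x ≤ N ↔ ∀ g : G, g * x * g⁻¹ * x⁻¹ ∈ N := by
  refine ⟨fun h g => h (conj_mul_inv_mem x g), fun h => (Subgroup.closure_le N).2 ?_⟩
  rintro _ ⟨_, ⟨g, rfl⟩, rfl⟩
  exact h g

instance normal (x : G) : (displacementSubgroup x).Normal := by
  refine ⟨fun n hn g => ?_⟩
  have key : displacementSubgroup x ≤
      (displacementSubgroup x).comap (MulAut.conj g).toMonoidHom := by
    refine le_iff.2 fun k => ?_
    have h := mul_mem (conj_mul_inv_mem x (g * k)) (inv_mem (conj_mul_inv_mem x g))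
    simpa [mul_assoc] using h
  simpa using key hn

/-- If `G = N * C_G(x)`, every conjugate of `x` is congruent to `x` modulo `N`. -/
theorem le_of_mul_centralizer_eq_univ {N : Subgroup G} [N.Normal]
    (h : (N : Set G) * (Subgroup.centralizer {x} : Set G) = Set.univ) :
    displacementSubgroup x ≤ N := by
  refine le_iff.2 fun g => ?_
  obtain ⟨n, hn, c, hc, rfl⟩ : g ∈ (N : Set G) * (Subgroup.centralizer {x} : Set G) :=
    h ▸ Set.mem_univ g
  have hcx : c * x = x * c := Subgroup.mem_centralizer_singleton_iff.1 hc
  have hconj : n * c * x * (n * c)⁻¹ * x⁻¹ = n * (x * n⁻¹ * x⁻¹) := by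
    rw [mul_assoc n c x, hcx]
    group
  simp only [hconj]
  exact mul_mem hn (‹N.Normal›.conj_mem _ (inv_mem hn) x)

/-- If the class of `x` generates `G`, then `G` is the product of the displacement group
and `⟨x⟩`. -/
theorem mul_zpowers_eq_univ
    (hgen : Subgroup.closure {z : G | ∃ g : G, g * x * g⁻¹ = z} = ⊤) :
    (displacementSubgroup x : Set G) * (Subgroup.zpowers x : Set G) = Set.univ := by
  rw [← Subgroup.normal_mul, ← Subgroup.coe_top, SetLike.coe_set_eq, eq_top_iff, ← hgen,
    Subgroup.closure_le]
  rintro _ ⟨g, rfl⟩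
  simpa using Subgroup.mul_mem_sup (conj_mul_inv_mem x g) (Subgroup.mem_zpowers x)

theorem one : displacementSubgroup (1 : G) = ⊥ :=
  le_bot_iff.1 (le_iff.2 fun g => by simp)

end displacementSubgroup

theorem displacement_tfae {G : Type*} [Group G] [Fintype G] (p : ℕ) (hp : p.Prime)
    (x : G) (hx : ∃ n : ℕ, orderOf x = p ^ n)
    (hgen : Subgroup.closure {z : G | ∃ g : G, g * x * g⁻¹ = z} = ⊤) :
    List.TFAE
      [ -- (i) G = O_{p'}(G) C_G(x)
        (∃ N : Subgroup G, N.Normal ∧ ¬ p ∣ Nat.card N ∧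
          (N : Set G) * (Subgroup.centralizer {x} : Set G) = Set.univ),
        -- (ii) ⟨x⟩ has a normal p-complement
        (∃ H : Subgroup G, H.Normal ∧ Nat.Coprime (Nat.card H) p ∧
          (H : Set G) * (Subgroup.zpowers x : Set G) = Set.univ),
        -- (iii) G = D⟨x⟩, D ∩ ⟨x⟩ = 1 and |D| coprime to |x|
        ((Subgroup.closure {w : G | ∃ y ∈ {z : G | ∃ g : G, g * x * g⁻¹ = z}, w = y * x⁻¹}
              : Set G) * (Subgroup.zpowers x : Set G) = Set.univ ∧
          Subgroup.closure {w : G | ∃ y ∈ {z : G | ∃ g : G, g * x * g⁻¹ = z}, w = y * x⁻¹}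
              ⊓ Subgroup.zpowers x = ⊥ ∧
          Nat.Coprime
            (Nat.card (Subgroup.closure
              {w : G | ∃ y ∈ {z : G | ∃ g : G, g * x * g⁻¹ = z}, w = y * x⁻¹}))
            (orderOf x)) ] := by
  obtain ⟨n, hn⟩ := hx
  tfae_have 1 → 3 := by
    rintro ⟨N, hN, hpN, h⟩
    have hcop : (Nat.card (displacementSubgroup x)).Coprime (orderOf x) := by
      rw [hn]
      exact (((hp.coprime_iff_not_dvd.2 hpN).symm.coprime_dvd_left
        (Subgroup.card_dvd_of_le
          (displacementSubgroup.le_of_mul_centralizer_eq_univ h))).pow_right n)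
    exact ⟨displacementSubgroup.mul_zpowers_eq_univ hgen,
      (Subgroup.disjoint_of_coprime_natCard (by rwa [Nat.card_zpowers])).eq_bot, hcop⟩
  tfae_have 3 → 2 := by
    rintro ⟨hmul, -, hcop⟩
    refine ⟨displacementSubgroup x, inferInstance, ?_, hmul⟩
    rcases n.eq_zero_or_pos with rfl | hpos
    · obtain rfl : x = 1 := by simpa using hn
      simp [displacementSubgroup.one]
    · rw [hn] at hcop
      exact (Nat.coprime_pow_right_iff hpos _ _).1 hcop
  tfae_have 2 → 1 := by
    rintro ⟨H, hH, hcop, h⟩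
    refine ⟨H, hH, hp.coprime_iff_not_dvd.1 hcop.symm, Set.eq_univ_of_univ_subset ?_⟩
    rw [← h]
    refine Set.mul_subset_mul_left (SetLike.coe_subset_coe.2 ?_)
    rw [Subgroup.zpowers_le, Subgroup.mem_centralizer_singleton_iff]
  tfae_finish
end

section
/- Let L be a nonabelian simple group, t a natural number, and D = {(x, x, …, x) : x ∈ L} the diagonal subgroup of the direct power L^t. If H is a subgroup of L^t with D ≤ H ≤ L^t, then there exists an equivalence relation α on the index set {1, …, t} such that H = {(x_1, …, x_t) ∈ L^t : x_i = x_j whenever i α j}. -/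
/-- In a nonabelian simple group every nontrivial element fails to commute with some element. -/
theorem exists_not_commute_of_ne_one {L : Type*} [Group L] [IsSimpleGroup L]
    (hna : ¬ ∀ a b : L, a * b = b * a) {y : L} (hy : y ≠ 1) : ∃ x : L, y * x ≠ x * y := by
  by_contra! h
  rcases (inferInstance : (Subgroup.center L).Normal).eq_bot_or_eq_top with hZ | hZ
  · exact hy <| Subgroup.mem_bot.1 <| hZ ▸ Subgroup.mem_center_iff.2 fun x => (h x).symm
  · exact hna fun a b => Subgroup.mem_center_iff.1 (hZ ▸ Subgroup.mem_top b) a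

/-- A subgroup `H` of a power of a nonabelian simple group that contains the diagonal and separates
the coordinate `j` from each coordinate in `S` contains an element with prescribed value at `j`
that is trivial on `S`. -/
theorem exists_mem_eq_and_eq_one_on {L ι : Type*} [Group L] [IsSimpleGroup L]
    (hna : ¬ ∀ a b : L, a * b = b * a) {H : Subgroup (ι → L)}
    (hD : ∀ x : L, (fun _ => x : ι → L) ∈ H) (j : ι) (S : Finset ι)
    (hS : ∀ i ∈ S, ∃ f ∈ H, f i ≠ f j) (x : L) :
    ∃ h ∈ H, h j = x ∧ ∀ i ∈ S, h i = 1 := by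
  classical
  induction S using Finset.induction_on generalizing x with
  | empty => exact ⟨_, hD x, rfl, by simp⟩
  | insert i S _ ih =>
    let N : Subgroup L :=
      { carrier := {x | ∃ h ∈ H, h j = x ∧ ∀ k ∈ insert i S, h k = 1}
        one_mem' := ⟨1, H.one_mem, rfl, fun _ _ => rfl⟩
        mul_mem' := by
          rintro _ _ ⟨g, hg, rfl, hg1⟩ ⟨h, hh, rfl, hh1⟩
          exact ⟨g * h, H.mul_mem hg hh, rfl, fun k hk => by simp [hg1 k hk, hh1 k hk]⟩
        inv_mem' := by
          rintro _ ⟨g, hg, rfl, hg1⟩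
          exact ⟨g⁻¹, H.inv_mem hg, rfl, fun k hk => by simp [hg1 k hk]⟩ }
    have hN : N.Normal := by
      constructor
      rintro _ ⟨h, hh, rfl, hh1⟩ y
      exact ⟨_, H.mul_mem (H.mul_mem (hD y) hh) (H.inv_mem (hD y)), rfl,
        fun k hk => by simp [hh1 k hk]⟩
    suffices hx : x ∈ N from hx
    rcases hN.eq_bot_or_eq_top with hbot | htop
    · obtain ⟨f, hf, hij⟩ := hS i (Finset.mem_insert_self i S)
      obtain ⟨y, hy⟩ := exists_not_commute_of_ne_one hna (y := (f i)⁻¹ * f j)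
        fun h => hij (inv_mul_eq_one.1 h)
      obtain ⟨h, hh, rfl, hh1⟩ := ih (fun k hk => hS k (Finset.mem_insert_of_mem hk)) y
      let g : ι → L := (fun _ => f i)⁻¹ * f
      have hg : g ∈ H := H.mul_mem (H.inv_mem (hD (f i))) hf
      have hgi : g i = 1 := inv_mul_cancel (f i)
      have hmem : g j * h j * (g j)⁻¹ * (h j)⁻¹ ∈ N := by
        refine ⟨g * h * g⁻¹ * h⁻¹,
          H.mul_mem (H.mul_mem (H.mul_mem hg hh) (H.inv_mem hg)) (H.inv_mem hh), rfl, ?_⟩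
        intro k hk
        rcases Finset.mem_insert.1 hk with rfl | hk
        · simp [hgi]
        · simp [hh1 k hk]
      rw [hbot, Subgroup.mem_bot, mul_inv_eq_one, mul_inv_eq_iff_eq_mul] at hmem
      exact absurd hmem hy
    · exact htop ▸ Subgroup.mem_top x

theorem subgroup_containing_diagonal {L : Type*} [Group L] [IsSimpleGroup L]
    (hna : ¬ ∀ a b : L, a * b = b * a) (t : ℕ)
    (H : Subgroup (Fin t → L)) (hD : ∀ x : L, (fun _ => x : Fin t → L) ∈ H) :
    ∃ r : Fin t → Fin t → Prop, Equivalence r ∧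
      ∀ f : Fin t → L, f ∈ H ↔ ∀ i j : Fin t, r i j → f i = f j := by
  refine ⟨fun i j => ∀ f ∈ H, f i = f j,
    ⟨fun _ _ _ => rfl, fun h f hf => (h f hf).symm, fun h h' f hf => (h f hf).trans (h' f hf)⟩,
    fun f => ⟨fun hf i j h => h f hf, fun hf => ?_⟩⟩
  have key : ∀ T : Finset (Fin t), ∃ h ∈ H, ∀ i ∈ T, h i = f i := by
    intro T
    induction T using Finset.induction_on with
    | empty => exact ⟨1, H.one_mem, by simp⟩
    | insert j T _ ih =>
      obtain ⟨h, hh, hT⟩ := ih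
      by_cases hj : ∃ i ∈ T, ∀ g ∈ H, g i = g j
      · obtain ⟨i, hi, hij⟩ := hj
        refine ⟨h, hh, Finset.forall_mem_insert _ _ _ |>.2 ⟨?_, hT⟩⟩
        rw [← hij h hh, hT i hi, hf i j hij]
      · push Not at hj
        obtain ⟨k, hk, hkj, hk1⟩ := exists_mem_eq_and_eq_one_on hna hD j T hj ((h j)⁻¹ * f j)
        refine ⟨h * k, H.mul_mem hh hk, Finset.forall_mem_insert _ _ _ |>.2 ⟨?_, fun i hi => ?_⟩⟩
        · simp [hkj]
        · simp [hk1 i hi, hT i hi]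
  obtain ⟨h, hh, hT⟩ := key Finset.univ
  rwa [← funext fun i => hT i (Finset.mem_univ i)]
end

section
/- Let L be a nonabelian finite simple group, t ≥ 2 a natural number, D = {(x, …, x) : x ∈ L} the diagonal subgroup of L^t, and σ the cyclic shift automorphism of L^t given by σ(x_1, …, x_t) = (x_t, x_1, …, x_{t-1}). Then the following are equivalent: (i) every σ-invariant subgroup H of L^t with D ≤ H satisfies H = D or H = L^t (i.e. D is a maximal σ-invariant subgroup of L^t); (ii) t is prime. -/
/-- The diagonal subgroup of constant tuples in the direct power `Fin t → L`. -/
def diagonalSubgroup (L : Type*) [Group L] (t : ℕ) : Subgroup (Fin t → L) :=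
  (MonoidHom.mk' (fun x : L => (fun _ => x : Fin t → L)) (fun _ _ => rfl)).range

/-- The elements of `L` that occur as the `j`-th coordinate of an element of `H` which is trivial
on `S`. It is normal as soon as `H` contains the constant tuples. -/
def coordinateSubgroup {L ι : Type*} [Group L] (H : Subgroup (ι → L)) (S : Set ι) (j : ι) :
    Subgroup L where
  carrier := {x | ∃ f ∈ H, (∀ i ∈ S, f i = 1) ∧ f j = x}
  one_mem' := ⟨1, H.one_mem, fun _ _ => rfl, rfl⟩
  mul_mem' := by
    rintro _ _ ⟨f, hf, hfS, rfl⟩ ⟨g, hg, hgS, rfl⟩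
    exact ⟨f * g, H.mul_mem hf hg, fun i hi => by simp [hfS i hi, hgS i hi], rfl⟩
  inv_mem' := by
    rintro _ ⟨f, hf, hfS, rfl⟩
    exact ⟨f⁻¹, H.inv_mem hf, fun i hi => by simp [hfS i hi], rfl⟩

theorem coordinateSubgroup_eq_top_of_ne_one {L ι : Type*} [Group L] [IsSimpleGroup L]
    {H : Subgroup (ι → L)} (hD : ∀ x : L, (fun _ => x) ∈ H) {S : Set ι} {j : ι}
    {f : ι → L} (hf : f ∈ H) (hfS : ∀ i ∈ S, f i = 1) (hfj : f j ≠ 1) :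
    coordinateSubgroup H S j = ⊤ := by
  have hn : (coordinateSubgroup H S j).Normal := by
    refine ⟨?_⟩
    rintro _ ⟨g, hg, hgS, rfl⟩ y
    exact ⟨(fun _ => y) * g * (fun _ => y)⁻¹,
      H.mul_mem (H.mul_mem (hD y) hg) (H.inv_mem (hD y)),
      fun i hi => by simp [hgS i hi], rfl⟩
  refine hn.eq_bot_or_eq_top.resolve_left fun h => hfj ?_
  have hmem : f j ∈ coordinateSubgroup H S j := ⟨f, hf, hfS, rfl⟩
  rwa [h, Subgroup.mem_bot] at hmem

/-- A subgroup of a finite direct power of a nonabelian simple group which contains the constant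
tuples and separates the coordinates is the whole power. -/
theorem eq_top_of_separates_coordinates {L ι : Type*} [Group L] [IsSimpleGroup L] [Finite ι]
    (hna : ¬ ∀ a b : L, a * b = b * a) {H : Subgroup (ι → L)}
    (hD : ∀ x : L, (fun _ => x) ∈ H) (hsep : ∀ i j, i ≠ j → ∃ f ∈ H, f i ≠ f j) : H = ⊤ := by
  classical
  have := Fintype.ofFinite ι
  have hone : ∀ i j, i ≠ j → coordinateSubgroup H {i} j = ⊤ := by
    intro i j hij
    obtain ⟨f, hf, hne⟩ := hsep i j hij
    refine coordinateSubgroup_eq_top_of_ne_one hD (f := (fun _ => f i)⁻¹ * f)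
      (H.mul_mem (H.inv_mem (hD _)) hf) (by simp) ?_
    simpa [inv_mul_eq_one] using hne
  have key : ∀ (S : Finset ι) (j : ι), j ∉ S → coordinateSubgroup H (S : Set ι) j = ⊤ := by
    intro S j
    induction S using Finset.induction_on with
    | empty =>
      intro _
      refine (Subgroup.eq_top_iff' _).2 fun x => ⟨fun _ => x, hD x, by simp, rfl⟩
    | insert i S hi ih =>
      intro hj
      rw [Finset.mem_insert, not_or] at hj
      push Not at hna
      obtain ⟨a, b, hab⟩ := hna
      obtain ⟨f, hf, hfS, rfl⟩ := (Subgroup.eq_top_iff' _).1 (ih hj.2) a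
      obtain ⟨g, hg, hgi, rfl⟩ := (Subgroup.eq_top_iff' _).1 (hone i j (Ne.symm hj.1)) b
      refine coordinateSubgroup_eq_top_of_ne_one hD (f := f * g * f⁻¹ * g⁻¹)
        (H.mul_mem (H.mul_mem (H.mul_mem hf hg) (H.inv_mem hf)) (H.inv_mem hg)) ?_ ?_
      · intro k hk
        rcases Finset.mem_insert.1 (Finset.mem_coe.1 hk) with rfl | hk
        · simp [hgi k rfl]
        · simp [hfS k hk]
      · intro h
        apply hab
        simpa [mul_inv_eq_one, mul_inv_eq_iff_eq_mul] using h
  rw [← top_le_iff, ← Subgroup.pi_top Set.univ, Subgroup.pi_le_iff]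
  rintro j _ ⟨x, -, rfl⟩
  obtain ⟨f, hf, hfS, hfj⟩ :=
    (Subgroup.eq_top_iff' _).1 (key (Finset.univ.erase j) j (by simp)) x
  convert hf
  ext k
  by_cases hk : k = j
  · subst hk
    simp [hfj]
  · simp [hk, hfS k (by simp [hk])]

/-- The common periods of the elements of a subgroup of `A → L`. -/
def commonPeriods {L A : Type*} [Group L] [AddGroup A] (H : Subgroup (A → L)) :
    AddSubgroup A where
  carrier := {k | ∀ f ∈ H, ∀ i, f (i + k) = f i}
  zero_mem' := by simp
  add_mem' := by
    intro a b ha hb f hf i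
    rw [← add_assoc, hb f hf, ha f hf]
  neg_mem' := by
    intro a ha f hf i
    rw [← ha f hf (i + -a), neg_add_cancel_right]

theorem comp_sub_mem_of_comp_sub_one_mem {L : Type*} [Group L] {t : ℕ} [NeZero t]
    {H : Subgroup (Fin t → L)} (hσ : ∀ f ∈ H, (fun i => f (i - 1)) ∈ H)
    {f : Fin t → L} (hf : f ∈ H) (k : Fin t) : (fun i => f (i - k)) ∈ H := by
  have h : ∀ n : ℕ, (fun i => f (i - n • (1 : Fin t))) ∈ H := by
    intro n
    induction n with
    | zero => simpa using hf
    | succ n ih =>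
      convert hσ _ ih using 3
      rw [succ_nsmul', sub_sub]
  have hk : k.val • (1 : Fin t) = k := by
    open scoped Fin.CommRing in
    rw [nsmul_one]
    exact Fin.cast_val_eq_self k
  simpa only [hk] using h k.val

/-- The tuples with period `a`. -/
def periodicSubgroup (L : Type*) {A : Type*} [Group L] [Add A] (a : A) : Subgroup (A → L) where
  carrier := {f | ∀ i, f (i + a) = f i}
  one_mem' _ := rfl
  mul_mem' := by
    intro f g hf hg i
    simp [hf i, hg i]
  inv_mem' := by
    intro f hf i
    simp [hf i]

theorem diagonal_maximal_shift_invariant_iff_prime {L : Type*} [Group L] [Finite L]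
    [IsSimpleGroup L] (hna : ¬ ∀ a b : L, a * b = b * a)
    (t : ℕ) [NeZero t] (ht : 2 ≤ t) :
    (∀ H : Subgroup (Fin t → L),
        diagonalSubgroup L t ≤ H →
        (∀ f : Fin t → L, f ∈ H ↔ (fun i => f (i - 1)) ∈ H) →
        H = diagonalSubgroup L t ∨ H = ⊤) ↔ t.Prime := by
  constructor
  · intro hmax
    by_contra hp
    obtain ⟨a, hat, ha2, hlt⟩ := Nat.exists_dvd_of_not_prime2 ht hp
    obtain ⟨x, hx⟩ := exists_ne (1 : L)
    have h10 : (1 : Fin t).val = 1 := by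
      rw [Fin.val_one', Nat.mod_eq_of_lt (by omega)]
    have hdiag : diagonalSubgroup L t ≤ periodicSubgroup L (⟨a, hlt⟩ : Fin t) := by
      rintro _ ⟨y, rfl⟩ i
      rfl
    have hshift (f : Fin t → L) : f ∈ periodicSubgroup L (⟨a, hlt⟩ : Fin t) ↔
        (fun i => f (i - 1)) ∈ periodicSubgroup L (⟨a, hlt⟩ : Fin t) := by
      constructor
      · intro hf i
        change f (i + _ - 1) = f (i - 1)
        rw [← hf (i - 1), sub_add_eq_add_sub]
      · intro hf i
        simpa [add_right_comm _ (1 : Fin t)] using hf (i + 1)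
    rcases hmax _ hdiag hshift with h | h
    · have hmem : (fun i : Fin t => if a ∣ i.val then x else 1) ∈
          periodicSubgroup L (⟨a, hlt⟩ : Fin t) := by
        intro i
        simp [Fin.val_add, Nat.dvd_mod_iff hat]
      rw [h] at hmem
      obtain ⟨y, hy⟩ := hmem
      have h0 := congrFun hy 0
      have h1 := congrFun hy 1
      have ha1 : a ≠ 1 := by omega
      simp only [MonoidHom.mk'_apply, Fin.val_zero, dvd_zero, if_true, h10, Nat.dvd_one, ha1,
        if_false] at h0 h1
      exact hx (h0.symm.trans h1)
    · have hmem : Pi.mulSingle 0 x ∈ periodicSubgroup L (⟨a, hlt⟩ : Fin t) :=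
        h ▸ Subgroup.mem_top _
      have h0 := hmem 0
      have ha0 : (⟨a, hlt⟩ : Fin t) ≠ 0 := by
        intro h
        have := congrArg Fin.val h
        simp at this
        omega
      rw [zero_add, Pi.mulSingle_eq_of_ne ha0, Pi.mulSingle_eq_same] at h0
      exact hx h0.symm
  · intro hp H hDH hσ
    have hD : ∀ x : L, (fun _ => x) ∈ H := fun x => hDH ⟨x, rfl⟩
    have := Fact.mk hp
    have : IsSimpleAddGroup (Fin t) := isSimpleAddGroup_of_prime_card (p := t) (by simp)
    rcases (inferInstance : (commonPeriods H).Normal).eq_bot_or_eq_top with h | h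
    · right
      refine eq_top_of_separates_coordinates hna hD fun i j hij => ?_
      have hnot : i - j ∉ commonPeriods H := by
        rwa [h, AddSubgroup.mem_bot, sub_eq_zero]
      have hex : ∃ f ∈ H, ∃ m, f (m + (i - j)) ≠ f m := by
        by_contra! hcon
        exact hnot hcon
      obtain ⟨f, hf, m, hm⟩ := hex
      refine ⟨_, comp_sub_mem_of_comp_sub_one_mem (fun f => (hσ f).1) hf (j - m), ?_⟩
      convert hm using 2 <;> abel
    · left
      refine le_antisymm (fun f hf => ⟨f 0, funext fun i => ?_⟩) hDH
      have hi : i ∈ commonPeriods H := h ▸ AddSubgroup.mem_top i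
      simpa using (hi f hf 0).symm
end

section
/- Let L be a nonabelian finite simple group, t ≥ 1 a natural number, σ ∈ Aut(L^t) the cyclic shift automorphism σ(x_1, …, x_t) = (x_t, x_1, …, x_{t-1}), W = L^t ⋊ ⟨σ⟩ the semidirect product of L^t with the cyclic subgroup of Aut(L^t) generated by σ, and x = (1, σ) ∈ W. The following are equivalent: (i) any two commuting elements of the conjugacy class x^W are equal (i.e. the conjugation quandle on x^W is superfaithful); (ii) x^W has the ⋆-property (i.e. the corresponding quandle is superconnected); (iii) the order of L is coprime to t. -/
/-- The cyclic shift automorphism of the direct power `Fin t → L`. -/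
def shiftAut (L : Type*) [Group L] (t : ℕ) [NeZero t] : MulAut (Fin t → L) where
  toFun f := fun i => f (i - 1)
  invFun f := fun i => f (i + 1)
  left_inv f := by funext i; simp
  right_inv f := by funext i; simp
  map_mul' f g := rfl

/-- A special case of Glauberman's lemma: if the automorphism `σ` preserves the subgroup `N` and the
coset `N f`, and some power `σ ^ n` with `n` coprime to `|N|` is trivial on both, then `σ` fixes a
point of `N f`. -/
theorem exists_mul_fixed_of_coprime {G : Type*} [Group G] (σ : MulAut G) (n : ℕ) :
    ∀ (N : Subgroup G) (f : G), Finite N → (Nat.card N).Coprime n →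
      (∀ m, σ m ∈ N ↔ m ∈ N) → σ f * f⁻¹ ∈ N →
      (∀ m ∈ N, (σ ^ n) m = m) → (σ ^ n) f = f → ∃ m ∈ N, σ (m * f) = m * f := by
  induction n using induction_on_primes with
  | zero =>
    intro N f _ hcop _ hf _ _
    have hN : N = ⊥ := Subgroup.eq_bot_of_card_eq N (by simpa using hcop)
    subst hN
    exact ⟨1, one_mem _, by simpa [mul_inv_eq_one] using hf⟩
  | one =>
    intro N f _ _ _ _ _ hfix
    exact ⟨1, one_mem _, by simpa using hfix⟩
  | prime_mul p k hp ih =>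
    intro N f _ hcop hN hf hNfix hffix
    have hcoset : ∀ g, σ g * f⁻¹ ∈ N ↔ g * f⁻¹ ∈ N := by
      intro g
      have h : σ g * f⁻¹ = σ (g * f⁻¹) * (σ f * f⁻¹) := by simp [mul_assoc]
      rw [h, N.mul_mem_cancel_right hf, hN]
    let s : Equiv.Perm {g : G // g * f⁻¹ ∈ N} := Equiv.Perm.subtypePerm σ.toEquiv hcoset
    have hs : ∀ (j : ℕ) (g), ((s ^ j) g : G) = (σ ^ j) (g : G) := by
      intro j
      induction j with
      | zero => intro g; rfl
      | succ j hj => intro g; rw [pow_succ, pow_succ, Equiv.Perm.mul_apply, hj]; rfl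
    let e : {g : G // g * f⁻¹ ∈ N} ≃ N :=
      { toFun := fun g => ⟨g * f⁻¹, g.2⟩
        invFun := fun m => ⟨m * f, by simp⟩
        left_inv := fun g => by simp
        right_inv := fun m => by simp }
    have : Finite {g : G // g * f⁻¹ ∈ N} := Finite.of_equiv _ e.symm
    have : Fintype {g : G // g * f⁻¹ ∈ N} := Fintype.ofFinite _
    have : Fact p.Prime := ⟨hp⟩
    have hpN : ¬ p ∣ Fintype.card {g : G // g * f⁻¹ ∈ N} := by
      rw [← Nat.card_eq_fintype_card, Nat.card_congr e, ← hp.coprime_iff_not_dvd]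
      exact (hcop.coprime_mul_right_right).symm
    have hsp : (s ^ k) ^ p ^ 1 = 1 := by
      ext g
      rw [pow_one, ← pow_mul, mul_comm, hs, Equiv.Perm.one_apply]
      have hg : (g : G) = g * f⁻¹ * f := by simp
      rw [hg, map_mul, hNfix _ g.2, hffix]
    obtain ⟨⟨g, hgN⟩, hg⟩ := Equiv.Perm.exists_fixed_point_of_prime hpN hsp
    have hgk : (σ ^ k) g = g := by rw [← hs k ⟨g, hgN⟩, hg]
    have hcomm : ∀ m, (σ ^ k) (σ m) = σ ((σ ^ k) m) := fun m => by
      rw [← MulAut.mul_apply, ← MulAut.mul_apply, ← pow_succ, pow_succ']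
    let N' : Subgroup G := N ⊓ (σ ^ k).toMonoidHom.eqLocus (MonoidHom.id G)
    have hmem : ∀ m, m ∈ N' ↔ m ∈ N ∧ (σ ^ k) m = m := fun m => Iff.rfl
    have hle : N' ≤ N := inf_le_left
    obtain ⟨m, hm, hfix⟩ := ih N' g (Finite.of_injective _ (Subgroup.inclusion_injective hle))
      ((hcop.coprime_mul_left_right).coprime_dvd_left (Subgroup.card_dvd_of_le hle))
      (fun m => by rw [hmem, hmem, hN, hcomm, σ.injective.eq_iff])
      (by
        rw [hmem]
        refine ⟨?_, by rw [map_mul, map_inv, hcomm, hgk]⟩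
        have h : σ g * g⁻¹ = σ g * f⁻¹ * (g * f⁻¹)⁻¹ := by group
        rw [h]
        exact mul_mem ((hcoset g).2 hgN) (inv_mem hgN))
      (fun m hm => hm.2) hgk
    exact ⟨m * (g * f⁻¹), mul_mem (hle hm) hgN, by simpa [mul_assoc] using hfix⟩

theorem starProperty_of_coprime {G : Type*} [Group G] (K : Subgroup G) [K.Normal] [Finite K]
    {x : G} {n : ℕ} (hx : x ^ n = 1) (hcop : (Nat.card K).Coprime n)
    (hK : ∀ g, g * x * g⁻¹ * x⁻¹ ∈ K) : StarProperty x := by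
  rintro y ⟨g, rfl⟩
  let H := Subgroup.closure ({x, g * x * g⁻¹} : Set G)
  have hxH : x ∈ H := Subgroup.subset_closure (by simp)
  have hyH : g * x * g⁻¹ ∈ H := Subgroup.subset_closure (by simp)
  have hle : H ⊓ K ≤ K := inf_le_right
  have hn : MulAut.conj x ^ n = 1 := by rw [← map_pow, hx, map_one]
  obtain ⟨m, hm, hfix⟩ := exists_mul_fixed_of_coprime (MulAut.conj x) n (H ⊓ K) g
    (Finite.of_injective _ (Subgroup.inclusion_injective hle))
    (hcop.coprime_dvd_left (Subgroup.card_dvd_of_le hle))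
    (fun m => by
      have hKm : x * m * x⁻¹ ∈ K ↔ m ∈ K :=
        ⟨fun h => by
          simpa [mul_assoc] using Subgroup.Normal.conj_mem ‹K.Normal› _ h x⁻¹,
          fun h => Subgroup.Normal.conj_mem ‹K.Normal› _ h x⟩
      rw [MulAut.conj_apply, Subgroup.mem_inf, Subgroup.mem_inf, hKm,
        H.mul_mem_cancel_right (inv_mem hxH), H.mul_mem_cancel_left hxH])
    (by
      have h : MulAut.conj x g * g⁻¹ = (g * x * g⁻¹ * x⁻¹)⁻¹ := by
        rw [MulAut.conj_apply]; group
      rw [h]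
      exact (H ⊓ K).inv_mem ⟨H.mul_mem hyH (H.inv_mem hxH), hK g⟩)
    (fun m _ => by rw [hn, MulAut.one_apply]) (by rw [hn, MulAut.one_apply])
  refine ⟨m⁻¹, inv_mem hm.1, ?_⟩
  rw [MulAut.conj_apply, mul_inv_eq_iff_eq_mul] at hfix
  calc g * x * g⁻¹ = m⁻¹ * (m * g * x) * g⁻¹ := by group
    _ = m⁻¹ * x * m⁻¹⁻¹ := by rw [← hfix]; group

theorem StarProperty.eq_of_commute {G : Type*} [Group G] {x : G} (h : StarProperty x) :
    ∀ y ∈ {w : G | ∃ g : G, g * x * g⁻¹ = w}, ∀ z ∈ {w : G | ∃ g : G, g * x * g⁻¹ = w},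
      y * z = z * y → y = z := by
  rintro _ ⟨a, rfl⟩ _ ⟨b, rfl⟩ hab
  obtain ⟨k, hk, hkx⟩ := h (a⁻¹ * b * x * (a⁻¹ * b)⁻¹) ⟨a⁻¹ * b, rfl⟩
  have hcomm : x * (a⁻¹ * b * x * (a⁻¹ * b)⁻¹) = a⁻¹ * b * x * (a⁻¹ * b)⁻¹ * x := by
    calc x * (a⁻¹ * b * x * (a⁻¹ * b)⁻¹)
        = a⁻¹ * (a * x * a⁻¹ * (b * x * b⁻¹)) * a := by group
      _ = a⁻¹ * b * x * (a⁻¹ * b)⁻¹ * x := by rw [hab]; group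
  have hle : Subgroup.closure {x, a⁻¹ * b * x * (a⁻¹ * b)⁻¹} ≤ Subgroup.centralizer {x} := by
    rw [Subgroup.closure_le]
    rintro w (rfl | rfl) <;> rw [SetLike.mem_coe, Subgroup.mem_centralizer_singleton_iff]
    exact hcomm.symm
  have hkc := Subgroup.mem_centralizer_singleton_iff.1 (hle hk)
  rw [hkc, mul_inv_cancel_right] at hkx
  calc a * x * a⁻¹ = a * (a⁻¹ * b * x * (a⁻¹ * b)⁻¹) * a⁻¹ := by rw [hkx]
    _ = b * x * b⁻¹ := by group

theorem shiftAut_apply (L : Type*) [Group L] (t : ℕ) [NeZero t] (f : Fin t → L) (i : Fin t) :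
    shiftAut L t f i = f (i - 1) := rfl

open scoped Fin.NatCast in
theorem shiftAut_pow_apply (L : Type*) [Group L] (t : ℕ) [NeZero t] (k : ℕ) (f : Fin t → L)
    (i : Fin t) : (shiftAut L t ^ k) f i = f (i - (k : Fin t)) := by
  induction k generalizing i with
  | zero => simp
  | succ k ih =>
    rw [pow_succ', MulAut.mul_apply, shiftAut_apply, ih]
    congr 1
    have h : ((k + 1 : ℕ) : Fin t) = (k : Fin t) + 1 := by
      ext; simp [Fin.val_add]
    rw [h]
    open scoped Fin.CommRing in ring

theorem shiftAut_pow_self (L : Type*) [Group L] (t : ℕ) [NeZero t] : shiftAut L t ^ t = 1 := by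
  ext f i
  rw [shiftAut_pow_apply]
  simp

/-- The function `i ↦ a ^ i` is multiplied by `a⁻¹` under the shift when `a ^ t = 1`. -/
theorem pow_fin_eq_mul_pow_sub_one {M : Type*} [Monoid M] {t : ℕ} [NeZero t] {a : M}
    (ha : a ^ t = 1) (i : Fin t) : a ^ (i : ℕ) = a * a ^ ((i - 1 : Fin t) : ℕ) := by
  obtain ⟨j, rfl⟩ : ∃ j : Fin t, i = j + 1 := ⟨i - 1, by simp⟩
  rw [add_sub_cancel_right, Fin.val_add, ← pow_eq_pow_mod _ ha, pow_add, Fin.val_one',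
    ← pow_eq_pow_mod _ ha, pow_one, ← pow_succ, pow_succ']

theorem simple_quandle_superfaithful_superconnected_tfae
    {L : Type*} [Group L] [Finite L] [IsSimpleGroup L]
    (hna : ¬ ∀ a b : L, a * b = b * a) (t : ℕ) [NeZero t] (ht : 1 ≤ t) :
    let σ := shiftAut L t
    let W := (Fin t → L) ⋊[(Subgroup.zpowers σ).subtype] (Subgroup.zpowers σ)
    let x : W := ⟨1, ⟨σ, Subgroup.mem_zpowers σ⟩⟩
    List.TFAE
      [ -- (i) superfaithful: commuting elements of the class are equal
        (∀ y ∈ {w : W | ∃ g : W, g * x * g⁻¹ = w},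
          ∀ z ∈ {w : W | ∃ g : W, g * x * g⁻¹ = w}, y * z = z * y → y = z),
        -- (ii) superconnected: the class has the ⋆-property
        StarProperty x,
        -- (iii) |L| is coprime to t
        Nat.Coprime (Nat.card L) t ] := by
  intro σ W x
  have hxt : x ^ t = 1 := by
    have h : x = SemidirectProduct.inr ⟨σ, Subgroup.mem_zpowers σ⟩ := rfl
    have hσ : (⟨σ, Subgroup.mem_zpowers σ⟩ : Subgroup.zpowers σ) ^ t = 1 :=
      Subtype.ext (shiftAut_pow_self L t)
    rw [h, ← map_pow, hσ, map_one]
  tfae_have 3 → 2 := by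
    intro hcop
    let r : W →* Subgroup.zpowers σ := SemidirectProduct.rightHom
    let K : Subgroup W := r.ker
    have hK : Nat.card K = Nat.card L ^ t := by
      have h : K = (SemidirectProduct.inl : (Fin t → L) →* W).range :=
        SemidirectProduct.range_inl_eq_ker_rightHom.symm
      rw [h, ← Nat.card_congr (MonoidHom.ofInjective SemidirectProduct.inl_injective).toEquiv]
      rw [Nat.card_fun, Nat.card_fin]
    have : Finite K := Nat.finite_of_card_ne_zero (by rw [hK]; exact pow_ne_zero _ Nat.card_pos.ne')
    refine starProperty_of_coprime K hxt (by rw [hK]; exact hcop.pow_left t) fun g => ?_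
    rw [MonoidHom.mem_ker]
    rw [map_mul r, map_mul r, map_mul r, map_inv r, map_inv r, mul_inv_eq_one,
      mul_inv_eq_iff_eq_mul, mul_comm']
  tfae_have 2 → 1 := StarProperty.eq_of_commute
  tfae_have 1 → 3 := by
    intro h
    by_contra hcop
    obtain ⟨p, hp, hpL, hpt⟩ := Nat.Prime.not_coprime_iff_dvd.1 hcop
    have : Fact p.Prime := ⟨hp⟩
    obtain ⟨a, ha⟩ := exists_prime_orderOf_dvd_card' p hpL
    have hat : a ^ t = 1 := orderOf_dvd_iff_pow_eq_one.1 (ha ▸ hpt)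
    let c : Fin t → L := fun _ => a
    let f : Fin t → L := fun i => a ^ (i : ℕ)
    have hf : f = c * σ f := funext fun i => pow_fin_eq_mul_pow_sub_one hat i
    have hxmul : ∀ v : Fin t → L, x * SemidirectProduct.inl v = SemidirectProduct.inl (σ v) * x := by
      intro v
      have hv := SemidirectProduct.inl_aut (φ := (Subgroup.zpowers σ).subtype)
        ⟨σ, Subgroup.mem_zpowers σ⟩ v
      rw [map_inv, eq_mul_inv_iff_mul_eq] at hv
      exact hv.symm
    have hconj : (SemidirectProduct.inl f : W) * x * (SemidirectProduct.inl f)⁻¹ =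
        SemidirectProduct.inl c * x := by
      rw [mul_inv_eq_iff_eq_mul, mul_assoc, hxmul, ← mul_assoc, ← map_mul, ← hf]
    have hxc := h x ⟨1, by simp⟩ (SemidirectProduct.inl c * x) ⟨_, hconj⟩ (by
      rw [← mul_assoc, hxmul]; rfl)
    have hc : c = 1 := SemidirectProduct.inl_injective (by
      rw [map_one]; exact right_eq_mul.1 hxc)
    have ha1 : a = 1 := congrFun hc 0
    rw [ha1, orderOf_one] at ha
    exact hp.one_lt.ne ha
  tfae_finish
end

section
/- Let Q be a quandle and for each y ∈ Q let L_y denote the bijection z ↦ y ◃ z of Q (left translation). Let LMlt(Q) be the subgroup of the permutation group of Q generated by {L_y : y ∈ Q}, and Dis(Q) the subgroup generated by {L_y ∘ L_z⁻¹ : y, z ∈ Q}. Then for every x ∈ Q, the stabilizer of x in LMlt(Q) equals Dis(Q)_x⟨L_x⟩; concretely, every h ∈ LMlt(Q) with h(x) = x can be written as h = g ∘ L_x^n for some integer n and some g ∈ Dis(Q) with g(x) = x. -/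
open Quandles

/-- The displacement group of a rack is normalized by every left translation. -/
theorem act'_mem_normalizer_closure {R : Type*} [Rack R] (a : R) :
    (Rack.act' a : Equiv.Perm R) ∈ Subgroup.normalizer (Subgroup.closure
      {p : Equiv.Perm R | ∃ y z : R, p = Rack.act' y * (Rack.act' z)⁻¹} : Set (Equiv.Perm R)) := by
  apply Subgroup.normalizer_le_normalizer_closure
  have hconj (b : R) : Rack.act' (a ◃ b) = Rack.act' a * Rack.act' b * (Rack.act' a)⁻¹ :=
    Rack.ad_conj a b
  rw [Subgroup.mem_set_normalizer_iff]
  intro p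
  constructor
  · rintro ⟨y, z, rfl⟩
    exact ⟨a ◃ y, a ◃ z, by rw [hconj, hconj]; group⟩
  · rintro ⟨y, z, hp⟩
    obtain ⟨y, rfl⟩ := (Rack.act' a).surjective y
    obtain ⟨z, rfl⟩ := (Rack.act' a).surjective z
    refine ⟨y, z, ?_⟩
    simp only [Rack.act'_apply, hconj] at hp
    have := congrArg (fun q => (Rack.act' a)⁻¹ * q * Rack.act' a) hp
    simpa [mul_assoc] using this

/-- Every element of the left multiplication group of a rack is a displacement followed by
a power of any given left translation. -/
theorem exists_displacement_mul_zpow {R : Type*} [Rack R] (x : R) {h : Equiv.Perm R}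
    (hh : h ∈ Subgroup.closure (Set.range (fun y : R => Rack.act' y))) :
    ∃ g ∈ Subgroup.closure
        {p : Equiv.Perm R | ∃ y z : R, p = Rack.act' y * (Rack.act' z)⁻¹},
      ∃ n : ℤ, g * (Rack.act' x) ^ n = h := by
  set D := Subgroup.closure
    {p : Equiv.Perm R | ∃ y z : R, p = Rack.act' y * (Rack.act' z)⁻¹}
  have hle : Subgroup.closure (Set.range (fun y : R => Rack.act' y)) ≤
      D ⊔ Subgroup.zpowers (Rack.act' x) := by
    rw [Subgroup.closure_le]
    rintro _ ⟨y, rfl⟩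
    have hy : Rack.act' y * (Rack.act' x)⁻¹ ∈ D := Subgroup.subset_closure ⟨y, x, rfl⟩
    simpa using Subgroup.mul_mem_sup hy (Subgroup.mem_zpowers (Rack.act' x))
  have hmem : h ∈ ((D ⊔ Subgroup.zpowers (Rack.act' x) : Subgroup (Equiv.Perm R)) :
      Set (Equiv.Perm R)) := hle hh
  rw [Subgroup.coe_mul_of_right_le_normalizer_left _ _
    (Subgroup.zpowers_le.2 (act'_mem_normalizer_closure x))] at hmem
  obtain ⟨g, hg, _, ⟨n, rfl⟩, hgn⟩ := Set.mem_mul.1 hmem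
  exact ⟨g, hg, n, hgn⟩

theorem stabilizer_eq_dis_stab_mul_zpowers {Q : Type*} [Quandle Q] (x : Q)
    (h : Equiv.Perm Q)
    (hh : h ∈ Subgroup.closure (Set.range (fun y : Q => Rack.act' y)))
    (hfix : h x = x) :
    ∃ n : ℤ,
      ∃ g ∈ Subgroup.closure
          {p : Equiv.Perm Q | ∃ y z : Q, p = Rack.act' y * (Rack.act' z)⁻¹},
        g x = x ∧ h = g * (Rack.act' x) ^ n := by
  obtain ⟨g, hg, n, rfl⟩ := exists_displacement_mul_zpow x hh
  have hx : ((Rack.act' x) ^ n) x = x :=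
    Equiv.Perm.zpow_apply_eq_self_of_apply_eq_self (Quandle.fix : x ◃ x = x) n
  refine ⟨n, g, hg, ?_, rfl⟩
  rwa [Equiv.Perm.mul_apply, hx] at hfix
end
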